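/- Let n ≥ 1, let m be an even positive integer and let p divide m. Then the groups G(m,p,n) and W(m,p,n) are NOT isomorphic as abstract groups (i.e. there is no multiplicative equivalence G(m,p,n) ≃* W(m,p,n)) if and only if n is even and m/p is odd. -/

import Mathlib

open MvPolynomial Finset

noncomputable section

/-- The diagonal torus: `n`-tuples of nonzero complex numbers. -/
abbrev Torus (n : ℕ) := Fin n → ℂˣ

/-- The permutation action of the symmetric group on the torus: `(w • t) i = t (w⁻¹ i)`. -/
def permAut (n : ℕ) : Equiv.Perm (Fin n) →* MulAut (Torus n) where
  toFun w := MulEquiv.arrowCongr w (MulEquiv.refl ℂˣ)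
  map_one' := rfl
  map_mul' _ _ := rfl

/-- `𝔾ₙ`, the group of monomial matrices, as the semidirect product
`(Fin n → ℂˣ) ⋊ Equiv.Perm (Fin n)`. -/
abbrev Gn (n : ℕ) := Torus n ⋊[permAut n] Equiv.Perm (Fin n)

/-- The set of inversions of a permutation `w`: pairs `(i,j)` with `i < j` and `w i > w j`. -/
def invFinset (n : ℕ) (w : Equiv.Perm (Fin n)) : Finset (Fin n × Fin n) :=
  Finset.univ.filter fun p : Fin n × Fin n => p.1 < p.2 ∧ w p.2 < w p.1

/-- The subgroup of `m`-th roots of unity in `ℂˣ`. -/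
def Cgrp (m : ℕ) : Subgroup ℂˣ where
  carrier := {z : ℂˣ | z ^ m = 1}
  one_mem' := one_pow m
  mul_mem' := by
    intro a b ha hb
    simp only [Set.mem_setOf_eq] at *
    rw [mul_pow, ha, hb, mul_one]
  inv_mem' := by
    intro a ha
    simp only [Set.mem_setOf_eq] at *
    rw [inv_pow, ha, inv_one]

/-- The sign character of the symmetric group, valued in `ℂˣ`. -/
def sgn (n : ℕ) : Equiv.Perm (Fin n) →* ℂˣ :=
  (Units.map (Int.castRingHom ℂ).toMonoidHom).comp Equiv.Perm.sign

/-- The product of the torus components, as a character of `𝔾ₙ`. -/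
def detT (n : ℕ) : Gn n →* ℂˣ where
  toFun g := ∏ i, g.left i
  map_one' := by simp
  map_mul' g h := by
    show (∏ i, (g.left i * h.left (g.right⁻¹ i))) = _
    rw [Finset.prod_mul_distrib]
    congr 1
    exact Equiv.prod_comp (g.right⁻¹ : Equiv.Perm _) h.left

/-- The determinant character of `𝔾ₙ`: the sign of the permutation part times the product
of the torus entries. -/
def detC (n : ℕ) : Gn n →* ℂˣ :=
  ((sgn n).comp (SemidirectProduct.rightHom)) * detT n

/-- The subgroup of `𝔾ₙ` of elements whose torus part has all entries in `C`. -/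
def TorusSub (n : ℕ) (C : Subgroup ℂˣ) : Subgroup (Gn n) where
  carrier := {g | ∀ i, g.left i ∈ C}
  one_mem' := by intro i; simp only [SemidirectProduct.one_left]; exact C.one_mem
  mul_mem' := by
    intro a b ha hb i
    exact C.mul_mem (ha i) (hb _)
  inv_mem' := by
    intro a ha i
    show (a⁻¹).left i ∈ C
    rw [SemidirectProduct.inv_left]
    exact C.inv_mem (ha _)

/-- The group `{(t,w) : (∀ i, t i ∈ C) ∧ ∏ i, t i ∈ C'}`; for `C = Cₘ`, `C' = C_{m/p}`
this is the complex reflection group `G(m,p,n)`. -/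
def GG (n : ℕ) (C C' : Subgroup ℂˣ) : Subgroup (Gn n) :=
  TorusSub n C ⊓ Subgroup.comap (detT n) C'

/-- The group `{(t,w) : (∀ i, t i ∈ C) ∧ sign w · ∏ i, t i ∈ C'}`; for `C = Cₘ`,
`C' = C_{m/p}` this is the mystic reflection group `W(m,p,n)`. -/
def WW (n : ℕ) (C C' : Subgroup ℂˣ) : Subgroup (Gn n) :=
  TorusSub n C ⊓ Subgroup.comap (detC n) C'

/-- The complex reflection group `G(m,p,n)` as a subgroup of `𝔾ₙ`. -/
def Gmpn (m p n : ℕ) : Subgroup (Gn n) := GG n (Cgrp m) (Cgrp (m / p))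

/-- The mystic reflection group `W(m,p,n)` as a subgroup of `𝔾ₙ`. -/
def Wmpn (m p n : ℕ) : Subgroup (Gn n) := WW n (Cgrp m) (Cgrp (m / p))

lemma neg_one_mem_Cgrp_iff (k : ℕ) : (-1 : ℂˣ) ∈ Cgrp k ↔ Even k := by
  change (-1 : ℂˣ) ^ k = 1 ↔ Even k
  rcases Nat.even_or_odd k with h | h
  · simp [h]
  · rw [h.neg_one_pow]
    simp only [Nat.not_even_iff_odd.mpr h, iff_false]
    intro h'
    have := congrArg Units.val h'
    norm_num at this

lemma sgn_eq_one_or (n : ℕ) (w : Equiv.Perm (Fin n)) : sgn n w = 1 ∨ sgn n w = -1 := by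
  rcases Int.units_eq_one_or (Equiv.Perm.sign w) with h | h
  · left; ext; simp [sgn, h]
  · right; ext; simp [sgn, h]

lemma finite_Cgrp {m : ℕ} (hm : 0 < m) : (Cgrp m : Set ℂˣ).Finite := by
  have : NeZero m := ⟨hm.ne'⟩
  have h : (Cgrp m : Set ℂˣ) = (rootsOfUnity m ℂ : Set ℂˣ) := by
    ext z
    exact (mem_rootsOfUnity m z).symm
  rw [h]
  exact inferInstanceAs (Finite (rootsOfUnity m ℂ))

lemma Gn_mul_left_apply {n : ℕ} (x y : Gn n) (i : Fin n) :
    (x * y).left i = x.left i * y.left (x.right⁻¹ i) := rfl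

lemma Gn_pow_right {n : ℕ} (x : Gn n) (k : ℕ) : (x ^ k).right = x.right ^ k :=
  map_pow SemidirectProduct.rightHom x k

lemma Gn_pow_left_apply {n : ℕ} (x : Gn n) (k : ℕ) (i : Fin n) :
    (x ^ k).left i = ∏ j ∈ range k, x.left ((x.right ^ j)⁻¹ i) := by
  induction k with
  | zero => simp
  | succ k ih => rw [pow_succ, Gn_mul_left_apply, ih, prod_range_succ, Gn_pow_right]

lemma Gn_pow_eq_one_iff {n : ℕ} (x : Gn n) (k : ℕ) :
    x ^ k = 1 ↔ x.right ^ k = 1 ∧ ∀ i, ∏ j ∈ range k, x.left ((x.right ^ j)⁻¹ i) = 1 := by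
  simp only [SemidirectProduct.ext_iff, Gn_pow_right, funext_iff, Gn_pow_left_apply,
    SemidirectProduct.one_left, SemidirectProduct.one_right, Pi.one_apply, and_comm]

lemma mem_Gmpn_iff {m p n : ℕ} {x : Gn n} :
    x ∈ Gmpn m p n ↔ (∀ i, x.left i ∈ Cgrp m) ∧ ∏ i, x.left i ∈ Cgrp (m / p) := Iff.rfl

lemma mem_Wmpn_iff {m p n : ℕ} {x : Gn n} :
    x ∈ Wmpn m p n ↔
      (∀ i, x.left i ∈ Cgrp m) ∧ sgn n x.right * ∏ i, x.left i ∈ Cgrp (m / p) := Iff.rfl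

lemma finite_Gmpn {m : ℕ} (hm : 0 < m) (p n : ℕ) : Finite (Gmpn m p n) := by
  have : Finite (Cgrp m) := finite_Cgrp hm
  refine Finite.of_injective
    (β := (Fin n → Cgrp m) × Equiv.Perm (Fin n))
    (fun x => (fun i => ⟨x.1.left i, (mem_Gmpn_iff.1 x.2).1 i⟩, x.1.right)) ?_
  intro x y h
  simp only [Prod.mk.injEq, funext_iff, Subtype.mk.injEq] at h
  exact Subtype.ext (SemidirectProduct.ext (funext h.1) h.2)

/-- When `-1 ∈ C_{m/p}`, the two determinant conditions coincide. -/
lemma Gmpn_eq_Wmpn_of_even {m p : ℕ} (n : ℕ) (h : Even (m / p)) : Gmpn m p n = Wmpn m p n := by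
  have hneg := (neg_one_mem_Cgrp_iff (m / p)).2 h
  ext x
  rw [mem_Gmpn_iff, mem_Wmpn_iff]
  have hs : sgn n x.right ∈ Cgrp (m / p) := by
    rcases sgn_eq_one_or n x.right with h | h <;> rw [h]
    exacts [one_mem _, hneg]
  rw [Subgroup.mul_mem_cancel_left _ hs]

lemma sgn_mul_self (n : ℕ) (w : Equiv.Perm (Fin n)) : sgn n w * sgn n w = 1 := by
  rcases sgn_eq_one_or n w with h | h <;> simp [h]

/-- The involution `(t, w) ↦ (sign w • t, w)` of `𝔾ₙ`. -/
def signTwistHom (n : ℕ) : Gn n →* Gn n where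
  toFun x := ⟨fun i => sgn n x.right * x.left i, x.right⟩
  map_one' := by ext <;> simp
  map_mul' x y := by
    refine SemidirectProduct.ext (funext fun i => ?_) rfl
    simp only [Gn_mul_left_apply, SemidirectProduct.mul_right, map_mul]
    exact mul_mul_mul_comm _ _ _ _

lemma signTwistHom_involutive (n : ℕ) (x : Gn n) : signTwistHom n (signTwistHom n x) = x := by
  refine SemidirectProduct.ext (funext fun i => ?_) rfl
  change sgn n x.right * (sgn n x.right * x.left i) = x.left i
  rw [← mul_assoc, sgn_mul_self, one_mul]

/-- `signTwistHom` as an automorphism of `𝔾ₙ`. -/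
def signTwist (n : ℕ) : Gn n ≃* Gn n :=
  MonoidHom.toMulEquiv (signTwistHom n) (signTwistHom n)
    (MonoidHom.ext (signTwistHom_involutive n)) (MonoidHom.ext (signTwistHom_involutive n))

lemma signTwist_mem_Wmpn_iff {m n : ℕ} (p : ℕ) (hm : Even m) (hn : Odd n) (x : Gn n) :
    signTwist n x ∈ Wmpn m p n ↔ x ∈ Gmpn m p n := by
  rw [mem_Gmpn_iff, mem_Wmpn_iff]
  change (∀ i, sgn n x.right * x.left i ∈ Cgrp m) ∧
    sgn n x.right * ∏ i, sgn n x.right * x.left i ∈ Cgrp (m / p) ↔ _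
  have hs : sgn n x.right ∈ Cgrp m := by
    rcases sgn_eq_one_or n x.right with h | h <;> rw [h]
    exacts [one_mem _, (neg_one_mem_Cgrp_iff m).2 hm]
  have hpow : sgn n x.right * sgn n x.right ^ n = 1 := by
    rcases sgn_eq_one_or n x.right with h | h <;> simp [h, hn.neg_one_pow]
  simp only [Subgroup.mul_mem_cancel_left _ hs, prod_mul_distrib, prod_const, card_univ,
    Fintype.card_fin, ← mul_assoc, hpow, one_mul]

lemma nonempty_mulEquiv_of_odd {m n : ℕ} (p : ℕ) (hm : Even m) (hn : Odd n) :
    Nonempty (Gmpn m p n ≃* Wmpn m p n) := by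
  have h : (Gmpn m p n).map (signTwist n).toMonoidHom = Wmpn m p n := by
    ext y
    constructor
    · rintro ⟨x, hx, rfl⟩
      exact (signTwist_mem_Wmpn_iff p hm hn x).2 hx
    · intro hy
      refine ⟨(signTwist n).symm y, ?_, (signTwist n).apply_symm_apply y⟩
      exact (signTwist_mem_Wmpn_iff p hm hn _).1 (by rwa [MulEquiv.apply_symm_apply])
  exact ⟨((signTwist n).subgroupMap _).trans (MulEquiv.subgroupCongr h)⟩

open Fin.CommRing in
lemma finRotate_pow_apply {n : ℕ} [NeZero n] (j : ℕ) (i : Fin n) :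
    (finRotate n ^ j) i = i + (j : Fin n) := by
  induction j with
  | zero => simp
  | succ j ih =>
    rw [pow_succ', Equiv.Perm.mul_apply, ih, finRotate_apply, Nat.cast_succ, add_assoc]

lemma finRotate_pow_self (n : ℕ) [NeZero n] : finRotate n ^ n = 1 := by
  ext i
  simp [finRotate_pow_apply]

open Fin.CommRing in
/-- An `n`-torsion monomial element lying over the standard `n`-cycle has torus part of
product `1`. -/
lemma prod_left_eq_one_of_right_eq_finRotate {n : ℕ} [NeZero n] (x : Gn n)
    (hx : x ^ n = 1) (hr : x.right = finRotate n) : ∏ i, x.left i = 1 := by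
  have hpow (j : ℕ) : (finRotate n ^ j)⁻¹ 0 = -(j : Fin n) := by
    rw [Equiv.Perm.inv_eq_iff_eq, finRotate_pow_apply, neg_add_cancel]
  have h := ((Gn_pow_eq_one_iff x _).1 hx).2 0
  simp only [hr, hpow, prod_range, Fin.cast_val_eq_self] at h
  rw [← h]
  exact (Equiv.prod_comp (Equiv.neg (Fin n)) x.left).symm

lemma sgn_finRotate_of_even {n : ℕ} (hn : 1 ≤ n) (he : Even n) : sgn n (finRotate n) = -1 := by
  obtain ⟨k, rfl⟩ := Nat.exists_eq_add_of_le' hn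
  have hk : Odd k := by simpa [Nat.even_add_one] using he
  ext
  simp [sgn, sign_finRotate, hk.neg_one_pow]

/-- Dividing the torus parts of two elements of `W(m,p,n)` over the same permutation gives an
element of `G(m,p,n)`. -/
lemma div_left_mem_Gmpn {m p n : ℕ} {x y : Gn n} (hx : x ∈ Wmpn m p n) (hy : y ∈ Wmpn m p n)
    (hr : x.right = y.right) : (⟨x.left / y.left, x.right⟩ : Gn n) ∈ Gmpn m p n := by
  rw [mem_Wmpn_iff] at hx hy
  rw [mem_Gmpn_iff]
  refine ⟨fun i => div_mem (hx.1 i) (hy.1 i), ?_⟩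
  have h := div_mem hx.2 hy.2
  rwa [hr, mul_div_mul_left_eq_div, ← prod_div_distrib] at h

lemma div_left_pow_eq_one {n k : ℕ} {x y : Gn n} (hx : x ^ k = 1) (hy : y ^ k = 1)
    (hr : x.right = y.right) : (⟨x.left / y.left, x.right⟩ : Gn n) ^ k = 1 := by
  rw [Gn_pow_eq_one_iff] at hx hy ⊢
  refine ⟨hx.1, fun i => ?_⟩
  have hy' := hy.2 i
  rw [← hr] at hy'
  simp only [Pi.div_apply, prod_div_distrib, hx.2 i, hy', div_one]

/-- For `n` even and `m / p` odd, `G(m,p,n)` has strictly more solutions of `x ^ n = 1`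
than `W(m,p,n)`. -/
lemma isEmpty_mulEquiv_of_even_of_odd {m n p : ℕ} (hn : 1 ≤ n) (hm : 0 < m) (he : Even n)
    (ho : Odd (m / p)) : IsEmpty (Gmpn m p n ≃* Wmpn m p n) := by
  refine ⟨fun e => ?_⟩
  have : NeZero n := ⟨by lia⟩
  have := finite_Gmpn hm p n
  let S := {x : Gmpn m p n // x ^ n = 1}
  let R := {x : Wmpn m p n // x ^ n = 1}
  have hbase (x : R) : ∃ y : R, y.1.1.right = x.1.1.right := ⟨x, rfl⟩
  let base (w : Equiv.Perm (Fin n)) (h : ∃ y : R, y.1.1.right = w) : R := h.choose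
  have base_right (w) (h : ∃ y : R, y.1.1.right = w) : (base w h).1.1.right = w :=
    h.choose_spec
  have hpow (x : R) : x.1.1 ^ n = 1 := by exact_mod_cast congrArg Subtype.val x.2
  let f (x : R) : S :=
    ⟨⟨⟨x.1.1.left / (base _ (hbase x)).1.1.left, x.1.1.right⟩,
      div_left_mem_Gmpn x.1.2 (base _ (hbase x)).1.2 (base_right _ _).symm⟩,
      Subtype.ext (div_left_pow_eq_one (hpow x) (hpow _) (base_right _ _).symm)⟩
  have hf : Function.Injective f := by
    intro x y hxy
    have h : (f x).1.1 = (f y).1.1 := by rw [hxy]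
    have hr : x.1.1.right = y.1.1.right := (SemidirectProduct.ext_iff.1 h).2
    have hb : base _ (hbase x) = base _ (hbase y) := by congr 1
    have hl : x.1.1.left / (base _ (hbase x)).1.1.left =
      y.1.1.left / (base _ (hbase y)).1.1.left := (SemidirectProduct.ext_iff.1 h).1
    rw [hb, div_left_inj] at hl
    exact Subtype.ext (Subtype.ext (SemidirectProduct.ext hl hr))
  let g (x : S) : R := ⟨e x.1, by rw [← map_pow, x.2, map_one]⟩
  have hg : Function.Injective g := fun x y h =>
    Subtype.ext (e.injective (congrArg Subtype.val h))
  have hsurj : Function.Surjective f :=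
    (Finite.injective_iff_surjective.1 (hf.comp hg)).of_comp
  let c : Gn n := SemidirectProduct.inr (finRotate n)
  have hc : c ∈ Gmpn m p n := by
    rw [mem_Gmpn_iff]
    simp [c, one_mem]
  have hcn : c ^ n = 1 := by
    rw [← map_pow, finRotate_pow_self, map_one]
  obtain ⟨x, hx⟩ := hsurj ⟨⟨c, hc⟩, Subtype.ext hcn⟩
  have hr : x.1.1.right = finRotate n :=
    congrArg (fun s : S => s.1.1.right) hx
  have hW := (mem_Wmpn_iff.1 x.1.2).2
  rw [prod_left_eq_one_of_right_eq_finRotate _ (hpow x) hr, hr, sgn_finRotate_of_even hn he,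
    mul_one, neg_one_mem_Cgrp_iff] at hW
  exact Nat.not_even_iff_odd.2 ho hW

/-- Theorem 2.8: `G(m,p,n)` and `W(m,p,n)` are not isomorphic as abstract groups if and only
if `n` is even and `m/p` is odd. -/
theorem not_iso_iff (n m p : ℕ) (hn : 1 ≤ n) (hm : 0 < m) (hme : Even m) (hpm : p ∣ m) :
    IsEmpty ((Gmpn m p n) ≃* (Wmpn m p n)) ↔ (Even n ∧ Odd (m / p)) := by
  refine ⟨fun h => ?_, fun h => isEmpty_mulEquiv_of_even_of_odd hn hm h.1 h.2⟩
  by_contra hc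
  rw [not_and_or, Nat.not_even_iff_odd, Nat.not_odd_iff_even] at hc
  rcases hc with hodd | heven
  · exact not_isEmpty_iff.2 (nonempty_mulEquiv_of_odd p hme hodd) h
  · exact h.false (MulEquiv.subgroupCongr (Gmpn_eq_Wmpn_of_even n heven))

end
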